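/- Let $A$ be a finite-dimensional self-injective $k$-algebra, $P = Ae$ an indecomposable projective left ideal with $e$ primitive idempotent, $u \in \mathrm{Soc}(P)$ nonzero, and $M$ a finite-dimensional $A$-module. Let $t = \dim_k(uP)$ be the rank of left multiplication by $u$ on $P$ and set $a = \dim_k(uM)/t$. Then $M \cong P^{\oplus a} \oplus M'$ where $M'$ is an $A$-module with no direct summand isomorphic to $P$. -/

import Mathlib

/-!
STATEMENT 1: With `A` a finite-dimensional self-injective `k`-algebra,
`P = Ae` an indecomposable projective left ideal (`e` a primitive idempotent),
`u ∈ Soc(P)` nonzero and `M` a finite-dimensional `A`-module, if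
`t = dim_k (uP)` and `a = dim_k (uM) / t` then `M ≅ P^{⊕ a} ⊕ M'` where `M'`
has no direct summand isomorphic to `P`.
-/

/-- Left multiplication by an element `u` of a `k`-algebra `A` on an
`A`-module `M`, as a `k`-linear map. -/
def smulMap {k A : Type} [CommSemiring k] [Semiring A] [Algebra k A]
    (u : A) (M : Type) [AddCommMonoid M] [Module A M] [Module k M]
    [IsScalarTower k A M] [SMulCommClass k A M] : M →ₗ[k] M where
  toFun m := u • m
  map_add' m n := smul_add u m n
  map_smul' c m := (smul_comm c u m).symm

/-- `u • M`, the image of left multiplication by `u`, as a `k`-subspace. -/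
def smulImage {k A : Type} [CommSemiring k] [Semiring A] [Algebra k A]
    (u : A) (M : Type) [AddCommMonoid M] [Module A M] [Module k M]
    [IsScalarTower k A M] [SMulCommClass k A M] : Submodule k M :=
  LinearMap.range (smulMap u M)

/-- An `A`-module `W` has a direct summand isomorphic to the module `V`. -/
def HasSummandIso (A : Type) [Ring A] (W : Type) [AddCommGroup W] [Module A W]
    (V : Type) [AddCommGroup V] [Module A V] : Prop :=
  ∃ (N N' : Submodule A W), IsCompl N N' ∧ Nonempty (↥N ≃ₗ[A] V)

section Helpers

variable {k A : Type} [Field k] [Ring A] [Algebra k A]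

theorem finrank_smulImage_congr (u : A) (M N : Type)
    [AddCommGroup M] [Module A M] [Module k M] [IsScalarTower k A M] [SMulCommClass k A M]
    [AddCommGroup N] [Module A N] [Module k N] [IsScalarTower k A N] [SMulCommClass k A N]
    (f : M ≃ₗ[A] N) :
    Module.finrank k (smulImage (k := k) u M) = Module.finrank k (smulImage (k := k) u N) := by
  have h : smulImage (k := k) u N =
      (smulImage (k := k) u M).map ((f.restrictScalars k : M ≃ₗ[k] N) : M →ₗ[k] N) := by
    ext x
    constructor
    · rintro ⟨y, rfl⟩
      refine ⟨u • f.symm y, ⟨f.symm y, rfl⟩, ?_⟩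
      change f (u • f.symm y) = u • y
      simp
    · rintro ⟨_, ⟨y, rfl⟩, rfl⟩
      refine ⟨f y, ?_⟩
      change u • f y = f (u • y)
      simp
  rw [h]
  exact ((f.restrictScalars k).submoduleMap (smulImage (k := k) u M)).finrank_eq

theorem finrank_smulImage_prod (u : A) (M N : Type)
    [AddCommGroup M] [Module A M] [Module k M] [IsScalarTower k A M] [SMulCommClass k A M]
    [AddCommGroup N] [Module A N] [Module k N] [IsScalarTower k A N] [SMulCommClass k A N]
    [FiniteDimensional k M] [FiniteDimensional k N] :
    Module.finrank k (smulImage (k := k) u (M × N)) =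
      Module.finrank k (smulImage (k := k) u M) + Module.finrank k (smulImage (k := k) u N) := by
  have h : smulImage (k := k) u (M × N) =
      (smulImage (k := k) u M).prod (smulImage (k := k) u N) := by
    ext ⟨x, y⟩
    constructor
    · rintro ⟨⟨p, q⟩, h⟩
      exact ⟨⟨p, congrArg Prod.fst h⟩, ⟨q, congrArg Prod.snd h⟩⟩
    · rintro ⟨⟨p, hp⟩, ⟨q, hq⟩⟩
      exact ⟨(p, q), Prod.ext hp hq⟩
  rw [h, ← Module.finrank_prod]
  exact LinearEquiv.finrank_eq
    { toFun := fun x => (⟨x.1.1, x.2.1⟩, ⟨x.1.2, x.2.2⟩)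
      invFun := fun y => ⟨(y.1.1, y.2.1), y.1.2, y.2.2⟩
      map_add' := fun _ _ => rfl
      map_smul' := fun _ _ => rfl
      left_inv := fun _ => rfl
      right_inv := fun _ => rfl }

theorem split_aux [FiniteDimensional k A] (P : Type) [AddCommGroup P] [Module A P]
    [Module.Injective A P] (M : Type) [AddCommGroup M] [Module A M]
    (f : P →ₗ[A] M) (hf : Function.Injective f) :
    ∃ r : M →ₗ[A] P, (∀ x, r (f x) = x) ∧ IsCompl (LinearMap.range f) (LinearMap.ker r) ∧
      Nonempty (M ≃ₗ[A] P × LinearMap.ker r) := by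
  obtain ⟨r, hr⟩ := Module.Injective.out (Q := P) f hf LinearMap.id
  have hc : IsCompl (LinearMap.range f) (LinearMap.ker r) := by
    constructor
    · rw [Submodule.disjoint_def]
      rintro _ ⟨x, rfl⟩ hx
      have : r (f x) = 0 := hx
      rw [hr] at this
      simp only [LinearMap.id_apply] at this
      simp [this]
    · rw [codisjoint_iff, eq_top_iff]
      intro m _
      rw [Submodule.mem_sup]
      refine ⟨f (r m), ⟨_, rfl⟩, m - f (r m), ?_, by abel⟩
      simp [LinearMap.mem_ker, hr]
  exact ⟨r, hr, hc, ⟨(Submodule.prodEquivOfIsCompl _ _ hc).symm.trans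
    ((LinearEquiv.ofInjective f hf).symm.prodCongr (LinearEquiv.refl A _))⟩⟩

theorem decomp_aux [FiniteDimensional k A] (u : A) (P : Type) [AddCommGroup P] [Module A P]
    [Module k P] [IsScalarTower k A P] [SMulCommClass k A P] [FiniteDimensional k P]
    [Module.Injective A P] (hP : ∃ p : P, u • p ≠ 0)
    (hinj : ∀ (M : Type) [AddCommGroup M] [Module A M] (m : M), u • m ≠ 0 →
      ∃ f : P →ₗ[A] M, Function.Injective f) (n : ℕ) :
    ∀ (M : Type) [AddCommGroup M] [Module A M] [Module k M]
    [IsScalarTower k A M] [SMulCommClass k A M] [FiniteDimensional k M],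
    Module.finrank k (smulImage (k := k) u M) = n →
    ∃ b : ℕ, n = b * Module.finrank k (smulImage (k := k) u P) ∧
    ∃ (M' : Type) (_ : AddCommGroup M') (_ : Module A M'),
      Nonempty (M ≃ₗ[A] (Fin b → P) × M') ∧ ¬ HasSummandIso A M' P := by
  have htpos : 0 < Module.finrank k (smulImage (k := k) u P) := by
    obtain ⟨p, hp⟩ := hP
    rw [Module.finrank_pos_iff_exists_ne_zero]
    exact ⟨⟨u • p, p, rfl⟩, fun h => hp (congrArg Subtype.val h)⟩
  induction n using Nat.strong_induction_on with
  | _ n ih =>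
  intro M _ _ _ _ _ _ hn
  by_cases hz : ∀ m : M, u • m = 0
  · refine ⟨0, ?_, M, inferInstance, inferInstance, ⟨?_⟩, ?_⟩
    · rw [zero_mul, ← hn]
      have : smulImage (k := k) u M = ⊥ := by
        rw [eq_bot_iff]
        rintro _ ⟨m, rfl⟩
        exact hz m
      rw [this]; simp
    · exact (LinearEquiv.uniqueProd (R := A) (M := M) (M₂ := Fin 0 → P)).symm
    · rintro ⟨N, N', -, ⟨g⟩⟩
      obtain ⟨p, hp⟩ := hP
      apply hp
      have h1 : u • g.symm p = 0 := Subtype.ext (hz _)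
      have h2 := congrArg g h1
      simpa using h2
  · push Not at hz
    obtain ⟨m, hm⟩ := hz
    obtain ⟨f, hf⟩ := hinj M m hm
    obtain ⟨r, -, -, ⟨g⟩⟩ := split_aux (k := k) P M f hf
    have hfd : FiniteDimensional k (LinearMap.ker r) :=
      inferInstanceAs (FiniteDimensional k ((LinearMap.ker r).restrictScalars k))
    have h1 := finrank_smulImage_congr (k := k) u _ _ g
    rw [finrank_smulImage_prod, hn] at h1
    obtain ⟨b, hb, M', i1, i2, ⟨g'⟩, hM'⟩ := ih _ (by omega) (LinearMap.ker r) rfl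
    refine ⟨b + 1, by rw [h1, hb]; ring, M', i1, i2, ⟨?_⟩, hM'⟩
    exact g.trans (((LinearEquiv.refl A P).prodCongr g').trans
      ((LinearEquiv.prodAssoc A P (Fin b → P) M').symm.trans
        ((Fin.consLinearEquiv A (fun _ : Fin (b + 1) => P)).prodCongr (LinearEquiv.refl A M'))))

end Helpers

theorem projective_multiplicity_from_socle
    {k A : Type} [Field k] [IsAlgClosed k] [Ring A] [Algebra k A]
    [FiniteDimensional k A]
    -- `A` is self-injective
    (self_inj : ∀ (N : Type) [AddCommGroup N] [Module A N],
      Module.Projective A N ↔ Module.Injective A N)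
    (e : A) (he : IsIdempotentElem e) (hprim : e ≠ 0)
    (hprim' : ∀ a b : A, IsIdempotentElem a → IsIdempotentElem b →
      a * b = 0 → b * a = 0 → a + b = e → a = 0 ∨ b = 0)
    (u : A) (hu0 : u ≠ 0)
    (huP : u ∈ Submodule.span A ({e} : Set A))
    (husimple : IsSimpleModule A ↥(Submodule.span A ({u} : Set A)))
    (hsoc : ∀ N : Submodule A A, N ≤ Submodule.span A ({e} : Set A) →
      IsSimpleModule A ↥N → N = Submodule.span A ({u} : Set A))
    (M : Type) [AddCommGroup M] [Module A M] [Module k M]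
    [IsScalarTower k A M] [SMulCommClass k A M] [FiniteDimensional k M]
    -- `t` is the rank of left multiplication by `u` on `P = Ae`
    (t : ℕ)
    (ht : t = Module.finrank k
      (Submodule.map (smulMap u A) ((Submodule.span A ({e} : Set A)).restrictScalars k)))
    -- `a = dim_k (uM) / t`
    (a : ℕ) (ha : a = Module.finrank k (smulImage (k := k) u M) / t) :
    ∃ (M' : Type) (_ : AddCommGroup M') (_ : Module A M'),
      Nonempty (M ≃ₗ[A] (Fin a → ↥(Submodule.span A ({e} : Set A))) × M') ∧
        ¬ HasSummandIso A M' ↥(Submodule.span A ({e} : Set A)) := by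
  have hmem : ∀ x : A, x ∈ Submodule.span A ({e} : Set A) → x * e = x := by
    intro x hx
    obtain ⟨c, rfl⟩ := Submodule.mem_span_singleton.1 hx
    rw [smul_eq_mul, mul_assoc, he.eq]
  have heP : e ∈ Submodule.span A ({e} : Set A) := Submodule.mem_span_singleton_self e
  have hproj : Module.Projective A (Submodule.span A ({e} : Set A)) := by
    refine Module.Projective.of_split (Submodule.subtype _)
      ((LinearMap.toSpanSingleton A (Submodule.span A ({e} : Set A)) ⟨e, heP⟩)) ?_
    ext x
    exact hmem x x.2
  have hPinj : Module.Injective A (Submodule.span A ({e} : Set A)) := (self_inj _).1 hproj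
  have hfd : FiniteDimensional k (Submodule.span A ({e} : Set A)) :=
    inferInstanceAs (FiniteDimensional k ((Submodule.span A ({e} : Set A)).restrictScalars k))
  have : IsArtinianRing A := IsArtinianRing.of_finite k A
  have hP : ∃ p : Submodule.span A ({e} : Set A), u • p ≠ 0 := by
    refine ⟨⟨e, heP⟩, fun h => hu0 ?_⟩
    have := congrArg Subtype.val h
    rw [← hmem u huP]
    exact this
  have hinj : ∀ (M : Type) [AddCommGroup M] [Module A M] (m : M), u • m ≠ 0 →
      ∃ f : Submodule.span A ({e} : Set A) →ₗ[A] M, Function.Injective f := by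
    intro M _ _ m hm
    refine ⟨(LinearMap.toSpanSingleton A M m).comp (Submodule.subtype _), ?_⟩
    rw [← LinearMap.ker_eq_bot]
    by_contra hne
    obtain ⟨S, hS, hle⟩ := (eq_bot_or_exists_atom_le (LinearMap.ker
      ((LinearMap.toSpanSingleton A M m).comp
        (Submodule.subtype (Submodule.span A ({e} : Set A)))))).resolve_left hne
    have hSs : IsSimpleModule A S := isSimpleModule_iff_isAtom.2 hS
    have hmap : IsSimpleModule A (S.map (Submodule.subtype _)) :=
      IsSimpleModule.congr (Submodule.equivMapOfInjective (Submodule.subtype _)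
        (Submodule.subtype_injective _) S).symm
    have h1 := hsoc _ (Submodule.map_subtype_le _ S) hmap
    have h2 : u ∈ S.map (Submodule.subtype _) := by
      rw [h1]; exact Submodule.mem_span_singleton_self u
    obtain ⟨x, hx, hxu⟩ := h2
    have h3 := hle hx
    apply hm
    rw [← hxu]
    exact h3
  have hteq : t = Module.finrank k
      (smulImage (k := k) u (Submodule.span A ({e} : Set A))) := by
    rw [ht]
    have h : Submodule.map (smulMap u A) ((Submodule.span A ({e} : Set A)).restrictScalars k) =
        (smulImage (k := k) u (Submodule.span A ({e} : Set A))).map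
          ((Submodule.subtype (Submodule.span A ({e} : Set A))).restrictScalars k) := by
      ext x
      constructor
      · rintro ⟨y, hy, rfl⟩
        exact ⟨_, ⟨⟨y, hy⟩, rfl⟩, rfl⟩
      · rintro ⟨_, ⟨y, rfl⟩, rfl⟩
        exact ⟨y.1, y.2, rfl⟩
    rw [h]
    exact (Submodule.equivMapOfInjective
      ((Submodule.subtype (Submodule.span A ({e} : Set A))).restrictScalars k)
      (Submodule.subtype_injective (Submodule.span A ({e} : Set A)))
      (smulImage (k := k) u (Submodule.span A ({e} : Set A)))).finrank_eq.symm
  obtain ⟨b, hb, hM⟩ := decomp_aux (k := k) u (Submodule.span A ({e} : Set A)) hP hinj _ M rfl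
  have htpos : 0 < t := by
    rw [hteq]
    obtain ⟨p, hp⟩ := hP
    rw [Module.finrank_pos_iff_exists_ne_zero]
    exact ⟨⟨u • p, p, rfl⟩, fun h => hp (congrArg Subtype.val h)⟩
  have hab : a = b := by
    rw [ha, hb, ← hteq, Nat.mul_div_cancel _ htpos]
  subst hab
  exact hM
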